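/- arXiv:1804.03935 — 3 statements merged into one kernel-verified Lean document; each statement's English description precedes it below -/
import Mathlib

section
/- Let X be a Banach space, T : ℓ₂ → X a compact linear operator, and K a nonempty compact subset of X with K ⊆ T(B_{ℓ₂}), where B_{ℓ₂} is the closed unit ball of the Hilbert sequence space ℓ₂. Then for every greedy sequence for K and every n ≥ 1, σ_{3n−1}(K)_X ≤ 3e²·Γ_n(X)·(∏_{k=0}^{n−1} d_k(T))^{1/n}. -/
open scoped BigOperators NNReal ENNReal

noncomputable section

/-- The span of the first `n` elements of the sequence `f`. -/
def greedySpan {X : Type*} [NormedAddCommGroup X] [NormedSpace ℝ X]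
    (f : ℕ → X) (n : ℕ) : Submodule ℝ X :=
  Submodule.span ℝ (f '' Set.Iio n)

/-- The `n`-th greedy error `σ_n = dist(f_n, V_n)`. For `n = 0` this is `‖f 0‖`. -/
def greedyErr {X : Type*} [NormedAddCommGroup X] [NormedSpace ℝ X]
    (f : ℕ → X) (n : ℕ) : ℝ :=
  Metric.infDist (f n) (greedySpan f n : Set X)

/-- `f` is a greedy sequence for `K`: each `f n` lies in `K` and maximizes the distance to
`V_n = span{f_0,…,f_{n-1}}` among elements of `K` (for `n = 0`, `‖f 0‖ = max_{g∈K} ‖g‖`). -/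
def IsGreedySeq {X : Type*} [NormedAddCommGroup X] [NormedSpace ℝ X]
    (K : Set X) (f : ℕ → X) : Prop :=
  ∀ n : ℕ, f n ∈ K ∧ ∀ g ∈ K, Metric.infDist g (greedySpan f n : Set X) ≤ greedyErr f n

/-- Kolmogorov `n`-width of a set `K ⊆ X`. -/
def kolWidth {X : Type*} [NormedAddCommGroup X] [NormedSpace ℝ X]
    (K : Set X) : ℕ → ℝ
  | 0 => ⨆ g ∈ K, ‖g‖
  | (n+1) => ⨅ L : {L : Submodule ℝ X // Module.finrank ℝ L = n + 1},
      ⨆ g ∈ K, Metric.infDist g (L.1 : Set X)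

/-- Kolmogorov `n`-width of a bounded linear operator `T : E → X`. -/
def kolWidthOp {E X : Type*} [NormedAddCommGroup E] [NormedSpace ℝ E]
    [NormedAddCommGroup X] [NormedSpace ℝ X] (T : E →L[ℝ] X) : ℕ → ℝ
  | 0 => ‖T‖
  | (n+1) => ⨅ L : {L : Submodule ℝ X // Module.finrank ℝ L = n + 1},
      ⨆ x : {x : E // ‖x‖ ≤ 1}, Metric.infDist (T x.1) (L.1 : Set X)

/-- Gelfand `n`-width of a bounded linear operator `T : E → X`. -/
def gelfandWidthOp {E X : Type*} [NormedAddCommGroup E] [NormedSpace ℝ E]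
    [NormedAddCommGroup X] [NormedSpace ℝ X] (T : E →L[ℝ] X) : ℕ → ℝ
  | 0 => ‖T‖
  | (n+1) => ⨅ L : {L : Submodule ℝ E // IsClosed (L : Set E) ∧
        FiniteDimensional ℝ (E ⧸ L) ∧ Module.finrank ℝ (E ⧸ L) ≤ n + 1},
      ⨆ x : {x : E // x ∈ L.1 ∧ ‖x‖ ≤ 1}, ‖T x.1‖

/-- The `n`-th Grothendieck number of a bounded linear operator `T : X → Y`. -/
def grothOp {X Y : Type*} [NormedAddCommGroup X] [NormedSpace ℝ X]
    [NormedAddCommGroup Y] [NormedSpace ℝ Y] (T : X →L[ℝ] Y) (n : ℕ) : ℝ :=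
  ⨆ p : (Fin n → {x : X // ‖x‖ ≤ 1}) × (Fin n → {b : Y →L[ℝ] ℝ // ‖b‖ ≤ 1}),
    |Matrix.det (Matrix.of fun i j => (p.2 j).1 (T (p.1 i).1))| ^ ((1 : ℝ) / n)

/-- The `n`-th Grothendieck number of the Banach space `X`. -/
def groth (X : Type*) [NormedAddCommGroup X] [NormedSpace ℝ X] (n : ℕ) : ℝ :=
  grothOp (ContinuousLinearMap.id ℝ X) n

/-- Banach–Mazur distance between two normed spaces. -/
def bmDist (X Y : Type*) [NormedAddCommGroup X] [NormedSpace ℝ X]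
    [NormedAddCommGroup Y] [NormedSpace ℝ Y] : ℝ :=
  ⨅ T : X ≃L[ℝ] Y, ‖(T : X →L[ℝ] Y)‖ * ‖(T.symm : Y →L[ℝ] X)‖

/-- `γ_n(X)`: supremum of Banach–Mazur distances of `n`-dimensional subspaces of `X`
to `n`-dimensional Euclidean space. -/
def gammaBM (X : Type*) [NormedAddCommGroup X] [NormedSpace ℝ X] (n : ℕ) : ℝ :=
  ⨆ V : {V : Submodule ℝ X // Module.finrank ℝ V = n},
    bmDist V.1 (EuclideanSpace ℝ (Fin n))

/-- `T` satisfies the absolutely 2-summing inequality with constant `C`. -/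
def Summing2Bound {X Y : Type*} [NormedAddCommGroup X] [NormedSpace ℝ X]
    [NormedAddCommGroup Y] [NormedSpace ℝ Y] (T : X →L[ℝ] Y) (C : ℝ) : Prop :=
  ∀ (N : ℕ) (x : Fin N → X),
    (∑ i, ‖T (x i)‖ ^ 2) ^ ((1 : ℝ) / 2) ≤
      C * ⨆ b : {b : X →L[ℝ] ℝ // ‖b‖ ≤ 1}, (∑ i, (b.1 (x i)) ^ 2) ^ ((1 : ℝ) / 2)

/-- `T` is absolutely 2-summing. -/
def IsSumming2 {X Y : Type*} [NormedAddCommGroup X] [NormedSpace ℝ X]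
    [NormedAddCommGroup Y] [NormedSpace ℝ Y] (T : X →L[ℝ] Y) : Prop :=
  ∃ C : ℝ, 0 ≤ C ∧ Summing2Bound T C

/-- The 2-summing norm `‖T | B₂‖`. -/
def summing2Norm {X Y : Type*} [NormedAddCommGroup X] [NormedSpace ℝ X]
    [NormedAddCommGroup Y] [NormedSpace ℝ Y] (T : X →L[ℝ] Y) : ℝ :=
  sInf {C : ℝ | 0 ≤ C ∧ Summing2Bound T C}

end
/-- Block Laplace estimate: if all minors of `M` with `card ι` rows and the columns of one block
are bounded by `g`, then `det M` is bounded by `g ^ card κ` times the number of colourings of the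
rows by `κ`. -/
theorem abs_det_le_of_block_minors {ι κ : Type*} [Fintype ι] [DecidableEq ι] [Fintype κ]
    [DecidableEq κ] (M : Matrix (ι × κ) (ι × κ) ℝ) {g : ℝ} (hg : 0 ≤ g)
    (h : ∀ (c : κ) (r : ι → ι × κ), |(Matrix.of fun i j => M (r i) (j, c)).det| ≤ g) :
    |M.det| ≤ (Fintype.card κ : ℝ) ^ Fintype.card (ι × κ) * g ^ Fintype.card κ := by
  set N : (ι × κ → κ) → Matrix (ι × κ) (ι × κ) ℝ :=
    fun r => Matrix.of fun p q => if q.2 = r p then M p q else 0 with hN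
  have hdet : M.det = ∑ r : ι × κ → κ, (N r).det := by
    have hM : M = fun p => ∑ c : κ, fun q : ι × κ => if q.2 = c then M p q else 0 := by
      ext p q
      simp [Finset.sum_apply]
    have := (Matrix.detRowAlternating (R := ℝ) (n := ι × κ)).toMultilinearMap.map_sum
      (fun (p : ι × κ) (c : κ) => fun q : ι × κ => if q.2 = c then M p q else 0)
    rw [← hM] at this
    exact this
  have hterm : ∀ r, |(N r).det| ≤ g ^ Fintype.card κ := by
    intro r
    by_cases h0 : (N r).det = 0
    · rw [h0, abs_zero]; positivity
    rw [Matrix.det_apply] at h0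
    obtain ⟨τ, -, hτ⟩ := Finset.exists_ne_zero_of_sum_ne_zero h0
    have hτ' : ∀ q : ι × κ, q.2 = r (τ q) := by
      intro q
      by_contra hq
      apply hτ
      rw [Finset.prod_eq_zero (Finset.mem_univ q) (by simp [hN, hq]), smul_zero]
    have hblock : (N r).submatrix τ id = Matrix.blockDiagonal
        fun c => Matrix.of fun i j => M (τ (i, c)) (j, c) := by
      ext ⟨i, c⟩ ⟨j, c'⟩
      rw [Matrix.blockDiagonal_apply]
      simp only [hN, Matrix.submatrix_apply, Matrix.of_apply, id, ← hτ' (i, c)]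
      by_cases hc : c = c'
      · subst hc; simp
      · simp [hc, Ne.symm hc]
    have habs : |(N r).det| = |((N r).submatrix τ id).det| := by
      rw [Matrix.det_permute, abs_mul]
      rcases Int.units_eq_one_or (Equiv.Perm.sign τ) with hs | hs <;> simp [hs]
    rw [habs, hblock, Matrix.det_blockDiagonal, Finset.abs_prod]
    exact (Finset.prod_le_prod (fun _ _ => abs_nonneg _) fun c _ => h c _).trans_eq (by simp)
  rw [hdet]
  refine (Finset.abs_sum_le_sum_abs _ _).trans ((Finset.sum_le_sum fun r _ => hterm r).trans ?_)
  simp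

/-- The alternating form `(x_i) ↦ det (b_j x_i)`. -/
noncomputable def detForm {X ι : Type*} [NormedAddCommGroup X] [NormedSpace ℝ X]
    [Fintype ι] [DecidableEq ι] (b : ι → X →L[ℝ] ℝ) : X [⋀^ι]→ₗ[ℝ] ℝ :=
  Matrix.detRowAlternating.compLinearMap (LinearMap.pi fun j => (b j : X →ₗ[ℝ] ℝ))

theorem detForm_apply {X ι : Type*} [NormedAddCommGroup X] [NormedSpace ℝ X]
    [Fintype ι] [DecidableEq ι] (b : ι → X →L[ℝ] ℝ) (x : ι → X) :
    detForm b x = (Matrix.of fun i j => b j (x i)).det := rfl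

theorem groth_nonneg (X : Type*) [NormedAddCommGroup X] [NormedSpace ℝ X] (n : ℕ) :
    0 ≤ groth X n :=
  Real.iSup_nonneg fun _ => by positivity

theorem abs_det_le_groth_pow {X : Type*} [NormedAddCommGroup X] [NormedSpace ℝ X] {n : ℕ}
    (hn : n ≠ 0) (x : Fin n → X) (b : Fin n → X →L[ℝ] ℝ) (hx : ∀ i, ‖x i‖ ≤ 1)
    (hb : ∀ j, ‖b j‖ ≤ 1) :
    |(Matrix.of fun i j => b j (x i)).det| ≤ groth X n ^ n := by
  have key : |(Matrix.of fun i j => b j (x i)).det| ^ ((1 : ℝ) / n) ≤ groth X n := by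
    refine le_ciSup (f := fun p : (Fin n → {x : X // ‖x‖ ≤ 1}) ×
      (Fin n → {b : X →L[ℝ] ℝ // ‖b‖ ≤ 1}) =>
      |Matrix.det (Matrix.of fun i j => (p.2 j).1 (p.1 i).1)| ^ ((1 : ℝ) / n)) ?_
      (fun i => ⟨x i, hx i⟩, fun j => ⟨b j, hb j⟩)
    refine ⟨((n.factorial : ℝ)) ^ ((1 : ℝ) / n), ?_⟩
    rintro _ ⟨p, rfl⟩
    refine Real.rpow_le_rpow (abs_nonneg _) ?_ (by positivity)
    have := Matrix.det_le (A := Matrix.of fun i j => (p.2 j).1 (p.1 i).1)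
      (abv := AbsoluteValue.abs) (x := (1 : ℝ)) fun i j => by
        have h := (p.2 j).1.le_opNorm (p.1 i).1
        have h' := mul_le_mul (p.2 j).2 (p.1 i).2 (norm_nonneg _) zero_le_one
        rw [Real.norm_eq_abs] at h
        simpa using h.trans h'
    simpa using this
  calc _ = (|(Matrix.of fun i j => b j (x i)).det| ^ ((1 : ℝ) / n)) ^ n := by
        rw [one_div, Real.rpow_inv_natCast_pow (abs_nonneg _) hn]
    _ ≤ _ := pow_le_pow_left₀ (by positivity) key n

/-- `Γ_{3n}(X) ≤ 3 Γ_n(X)`, in terms of determinants. -/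
theorem abs_detForm_le {X : Type*} [NormedAddCommGroup X] [NormedSpace ℝ X] {n : ℕ}
    (hn : n ≠ 0) (x : Fin (3 * n) → X) (b : Fin (3 * n) → X →L[ℝ] ℝ) (hx : ∀ i, ‖x i‖ ≤ 1)
    (hb : ∀ j, ‖b j‖ ≤ 1) :
    |detForm b x| ≤ (3 * groth X n) ^ (3 * n) := by
  let e : Fin n × Fin 3 ≃ Fin (3 * n) := (Equiv.prodComm _ _).trans finProdFinEquiv
  have h := abs_det_le_of_block_minors ((Matrix.of fun i j => b j (x i)).submatrix e e)
    (g := groth X n ^ n) (pow_nonneg (groth_nonneg X n) n) fun c r =>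
      abs_det_le_groth_pow hn (fun i => x (e (r i))) (fun j => b (e (j, c)))
        (fun _ => hx _) (fun _ => hb _)
  rw [Matrix.det_submatrix_equiv_self] at h
  rw [detForm_apply]
  refine h.trans_eq ?_
  simp only [Fintype.card_prod, Fintype.card_fin, mul_pow, ← pow_mul, Nat.cast_ofNat]
  rw [mul_comm n 3]

/-- An alternating form bounded by `G` on the unit ball is small on vectors from a set `B` that is
well approximated by subspaces of small dimension. -/
theorem abs_alternating_le_of_approx {X ι : Type*} [NormedAddCommGroup X] [NormedSpace ℝ X]
    [Fintype ι] [DecidableEq ι] (F : X [⋀^ι]→ₗ[ℝ] ℝ) {G : ℝ}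
    (hF : ∀ v : ι → X, (∀ i, ‖v i‖ ≤ 1) → |F v| ≤ G) (B : Set X) (δ : ℕ → ℝ)
    (hδ : Antitone δ) (hδ0 : ∀ k, 0 < δ k)
    (hB : ∀ a, ∃ L : Submodule ℝ X, FiniteDimensional ℝ L ∧ Module.finrank ℝ L ≤ a ∧
      ∀ y ∈ B, ∃ l ∈ L, ‖y - l‖ ≤ δ a) :
    ∀ (q : ℕ) (Q : Finset ι), Q.card = q → ∀ v : ι → X, (∀ i ∈ Q, v i ∈ B) →
      (∀ i ∉ Q, ‖v i‖ ≤ 1) → |F v| ≤ G * 4 ^ q * ∏ k ∈ Finset.range q, δ (k / 3) := by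
  have hG : 0 ≤ G := (abs_nonneg _).trans (hF 0 (by simp))
  intro q
  induction q using Nat.strong_induction_on with
  | _ q ih =>
  intro Q hQ v hvB hv1
  rcases Nat.eq_zero_or_pos q with rfl | hq
  · rw [Finset.card_eq_zero] at hQ
    subst hQ
    simpa using hF v fun i => hv1 i (by simp)
  set a := q / 3 with ha
  have haq : a < q := Nat.div_lt_self hq (by norm_num)
  set P := ∏ k ∈ Finset.range q, δ (k / 3) with hP
  have hP0 : 0 ≤ P := Finset.prod_nonneg fun k _ => (hδ0 _).le
  obtain ⟨L, hLfd, hLrank, hL⟩ := hB a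
  have hl : ∀ i, ∃ l ∈ L, i ∈ Q → ‖v i - l‖ ≤ δ a := by
    intro i
    by_cases hi : i ∈ Q
    · obtain ⟨l, hl, h⟩ := hL _ (hvB i hi)
      exact ⟨l, hl, fun _ => h⟩
    · exact ⟨0, L.zero_mem, fun h => absurd h hi⟩
  choose l hlL hl using hl
  set w : ι → X := fun i => if i ∈ Q then v i - l i else v i with hw
  have hmixed : ∀ s ⊆ Q, s.card ≤ a → ∀ R ⊆ s,
      |F (R.piecewise v (fun i => if i ∈ s then -w i else w i))| ≤ G * P * 4 ^ R.card := by
    intro s hs hsa R hR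
    have hRQ : R ⊆ Q := hR.trans hs
    have hRa : R.card ≤ a := (Finset.card_le_card hR).trans hsa
    set c : ι → ℝ := fun i => if i ∈ Q \ R then δ a else 1 with hc
    set u : ι → X := R.piecewise v (fun i => if i ∈ s then -w i else w i) with hu
    have hsmul : u = fun i => c i • ((c i)⁻¹ • u i) := by
      funext i
      have : c i ≠ 0 := by
        simp only [hc]; split_ifs
        · exact (hδ0 a).ne'
        · exact one_ne_zero
      rw [smul_inv_smul₀ this]
    have hprod : ∏ i, c i = δ a ^ (q - R.card) := by
      simp only [hc]
      rw [Finset.prod_ite_mem, Finset.univ_inter, Finset.prod_const,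
        Finset.card_sdiff_of_subset hRQ, hQ]
    have hIH := ih R.card (hRa.trans_lt haq) R rfl (fun i => (c i)⁻¹ • u i)
      (fun i hi => by simpa [hc, hu, hi] using hvB i (hRQ hi))
      (fun i hi => by
        by_cases hiQ : i ∈ Q
        · have h1 : ‖u i‖ = ‖v i - l i‖ := by
            by_cases his : i ∈ s <;> simp [hu, hw, hi, hiQ, his, norm_sub_rev]
          have h2 : c i = δ a := by simp [hc, hi, hiQ]
          rw [norm_smul, h1, h2, norm_inv, Real.norm_of_nonneg (hδ0 a).le,
            inv_mul_le_one₀ (hδ0 a)]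
          exact hl i hiQ
        · have his : i ∉ s := fun h => hiQ (hs h)
          simpa [hc, hu, hw, hi, hiQ, his] using hv1 i hiQ)
    have htail : δ a ^ (q - R.card) * ∏ k ∈ Finset.range R.card, δ (k / 3) ≤ P := by
      rw [hP, ← Finset.prod_range_mul_prod_Ico _ (hRa.trans haq.le), mul_comm]
      refine mul_le_mul_of_nonneg_left ?_ (Finset.prod_nonneg fun k _ => (hδ0 _).le)
      rw [← Nat.card_Ico, ← Finset.prod_const]
      refine Finset.prod_le_prod (fun _ _ => (hδ0 a).le) fun k hk => hδ ?_
      exact Nat.div_le_div_right (Finset.mem_Ico.1 hk).2.le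
    rw [hsmul, F.map_smul_univ, hprod, smul_eq_mul, abs_mul,
      abs_of_nonneg (pow_nonneg (hδ0 a).le _)]
    calc _ ≤ δ a ^ (q - R.card) *
          (G * 4 ^ R.card * ∏ k ∈ Finset.range R.card, δ (k / 3)) :=
          mul_le_mul_of_nonneg_left hIH (pow_nonneg (hδ0 a).le _)
      _ = G * 4 ^ R.card * (δ a ^ (q - R.card) * ∏ k ∈ Finset.range R.card, δ (k / 3)) := by
          ring
      _ ≤ G * 4 ^ R.card * P := mul_le_mul_of_nonneg_left htail (by positivity)
      _ = _ := by ring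
  have hsub : ∀ s ⊆ Q, |F (s.piecewise l w)| ≤ G * P * 5 ^ a := by
    intro s hs
    rcases lt_or_ge a s.card with hsa | hsa
    · rw [F.map_linearDependent, abs_zero]
      · positivity
      intro hli
      have hli' : LinearIndependent ℝ fun i : s => (⟨l i, hlL i⟩ : L) := by
        refine LinearIndependent.of_comp L.subtype ?_
        have hcomp : (L.subtype ∘ fun i : s => (⟨l i, hlL i⟩ : L)) =
            s.piecewise l w ∘ fun i : s => (i : ι) := by
          funext i
          simp
        rw [hcomp]
        exact hli.comp _ Subtype.val_injective
      have := hli'.fintype_card_le_finrank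
      rw [Fintype.card_coe] at this
      omega
    · have hexp := F.toMultilinearMap.map_piecewise_add v
        (fun i => if i ∈ s then -w i else w i) s
      have hlhs : s.piecewise (v + fun i => if i ∈ s then -w i else w i)
          (fun i => if i ∈ s then -w i else w i) = s.piecewise l w := by
        funext i
        by_cases hi : i ∈ s
        · simp [hw, hi, hs hi]
        · simp [hi]
      rw [hlhs] at hexp
      have hexp' : F (s.piecewise l w) = ∑ R ∈ s.powerset,
        F (R.piecewise v (fun i => if i ∈ s then -w i else w i)) := hexp
      rw [hexp']
      refine (Finset.abs_sum_le_sum_abs _ _).trans ((Finset.sum_le_sum fun R hR =>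
        hmixed s hs hsa R (Finset.mem_powerset.1 hR)).trans ?_)
      rw [← Finset.mul_sum]
      refine mul_le_mul_of_nonneg_left ?_ (by positivity)
      have h5 := Finset.sum_pow_mul_eq_add_pow (4 : ℝ) 1 s
      simp only [one_pow, mul_one] at h5
      rw [h5]
      norm_num
      exact pow_le_pow_right₀ (by norm_num) hsa
  have hexp : F v = ∑ s ∈ Q.powerset, F (s.piecewise l w) := by
    have h := F.toMultilinearMap.map_piecewise_add l w Q
    have hlhs : Q.piecewise (l + w) w = v := by
      funext i
      by_cases hi : i ∈ Q <;> simp [hw, hi]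
    rw [hlhs] at h
    exact h
  have hnum : (2 : ℝ) ^ q * 5 ^ a ≤ 4 ^ q := by
    calc (2 : ℝ) ^ q * 5 ^ a ≤ 2 ^ q * 8 ^ a := by gcongr; norm_num
      _ = 2 ^ q * 2 ^ (3 * a) := by rw [pow_mul]; norm_num
      _ ≤ 2 ^ q * 2 ^ q := by
          gcongr
          · norm_num
          · omega
      _ = 4 ^ q := by rw [← mul_pow]; norm_num
  calc |F v| ≤ ∑ s ∈ Q.powerset, |F (s.piecewise l w)| := by
        rw [hexp]; exact Finset.abs_sum_le_sum_abs _ _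
    _ ≤ ∑ s ∈ Q.powerset, G * P * 5 ^ a :=
        Finset.sum_le_sum fun s hs => hsub s (Finset.mem_powerset.1 hs)
    _ = G * P * (2 ^ q * 5 ^ a) := by
        rw [Finset.sum_const, Finset.card_powerset, hQ, nsmul_eq_mul]; push_cast; ring
    _ ≤ G * P * 4 ^ q := mul_le_mul_of_nonneg_left hnum (by positivity)
    _ = _ := by ring

theorem kolWidthOp_nonneg {E X : Type*} [NormedAddCommGroup E] [NormedSpace ℝ E]
    [NormedAddCommGroup X] [NormedSpace ℝ X] (T : E →L[ℝ] X) (k : ℕ) : 0 ≤ kolWidthOp T k := by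
  cases k with
  | zero => exact norm_nonneg T
  | succ k => exact Real.iInf_nonneg fun _ => Real.iSup_nonneg fun _ => Metric.infDist_nonneg

theorem exists_approx_of_kolWidthOp {E X : Type*} [NormedAddCommGroup E] [NormedSpace ℝ E]
    [NormedAddCommGroup X] [NormedSpace ℝ X] (T : E →L[ℝ] X) (k : ℕ) {ε : ℝ} (hε : 0 < ε) :
    ∃ L : Submodule ℝ X, FiniteDimensional ℝ L ∧ Module.finrank ℝ L ≤ k ∧
      ∀ y ∈ T '' Metric.closedBall 0 1, ∃ l ∈ L, ‖y - l‖ ≤ kolWidthOp T k + ε := by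
  cases k with
  | zero =>
    refine ⟨⊥, inferInstance, by simp, ?_⟩
    rintro _ ⟨x, hx, rfl⟩
    refine ⟨0, Submodule.zero_mem _, ?_⟩
    have hT := T.le_opNorm_of_le (mem_closedBall_zero_iff.1 hx)
    rw [sub_zero, show kolWidthOp T 0 = ‖T‖ from rfl]
    linarith
  | succ k =>
    by_cases hne : Nonempty {L : Submodule ℝ X // Module.finrank ℝ L = k + 1}
    · obtain ⟨⟨L, hL⟩, hlt⟩ := exists_lt_of_ciInf_lt
        (show kolWidthOp T (k + 1) < kolWidthOp T (k + 1) + ε by linarith)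
      refine ⟨L, Module.finite_of_finrank_pos (by omega), hL.le, ?_⟩
      rintro _ ⟨x, hx, rfl⟩
      have hbdd : BddAbove (Set.range fun x : {x : E // ‖x‖ ≤ 1} =>
          Metric.infDist (T x.1) (L : Set X)) := by
        refine ⟨‖T‖, ?_⟩
        rintro _ ⟨z, rfl⟩
        refine (Metric.infDist_le_dist_of_mem L.zero_mem).trans ?_
        simpa using T.le_opNorm_of_le z.2
      have h := (le_ciSup hbdd ⟨x, mem_closedBall_zero_iff.1 hx⟩).trans_lt hlt
      obtain ⟨l, hl, hd⟩ := (Metric.infDist_lt_iff ⟨0, L.zero_mem⟩).1 h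
      exact ⟨l, hl, by rw [← dist_eq_norm]; exact hd.le⟩
    · have hrank : Module.rank ℝ X < ((k + 1 : ℕ) : Cardinal) := by
        by_contra! hle
        obtain ⟨v, hv⟩ := Module.le_rank_iff.1 hle
        exact hne ⟨Submodule.span ℝ (Set.range v), by simpa using finrank_span_eq_card hv⟩
      have hfd : FiniteDimensional ℝ X :=
        Module.rank_lt_aleph0_iff.1 (hrank.trans Cardinal.natCast_lt_aleph0)
      refine ⟨⊤, inferInstance, ?_, fun y _ => ⟨y, Submodule.mem_top, ?_⟩⟩
      · rw [finrank_top]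
        rw [← Module.finrank_eq_rank, Nat.cast_lt] at hrank
        exact hrank.le
      · have := kolWidthOp_nonneg T (k + 1)
        simp only [sub_self, norm_zero]
        linarith

/-- A norming functional for the distance to a closed subspace. -/
theorem exists_dual_eq_infDist {X : Type*} [NormedAddCommGroup X] [NormedSpace ℝ X]
    (V : Submodule ℝ X) (hV : IsClosed (V : Set X)) (x : X) :
    ∃ b : X →L[ℝ] ℝ, ‖b‖ ≤ 1 ∧ (∀ y ∈ V, b y = 0) ∧ b x = Metric.infDist x (V : Set X) := by
  have := hV
  obtain ⟨g, hg, hgx⟩ := exists_dual_vector'' ℝ (V.mkQ x)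
  have hle : ∀ y, ‖V.mkQ y‖ ≤ 1 * ‖y‖ := fun y => by
    rw [one_mul]; exact Submodule.Quotient.norm_mk_le V y
  refine ⟨g.comp (V.mkQ.mkContinuous 1 hle), ?_, ?_, ?_⟩
  · refine (g.opNorm_comp_le _).trans (mul_le_one₀ hg (norm_nonneg _) ?_)
    exact LinearMap.mkContinuous_norm_le _ zero_le_one _
  · intro y hy
    simp [(Submodule.Quotient.mk_eq_zero V).2 hy]
  · simp only [ContinuousLinearMap.comp_apply, LinearMap.mkContinuous_apply, hgx]
    exact QuotientAddGroup.norm_mk (S := V.toAddSubgroup) x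

theorem greedyErr_nonneg {X : Type*} [NormedAddCommGroup X] [NormedSpace ℝ X]
    (f : ℕ → X) (n : ℕ) : 0 ≤ greedyErr f n := Metric.infDist_nonneg

theorem IsGreedySeq.greedyErr_antitone {X : Type*} [NormedAddCommGroup X] [NormedSpace ℝ X]
    {K : Set X} {f : ℕ → X} (hf : IsGreedySeq K f) : Antitone (greedyErr f) := by
  intro m n hmn
  refine (Metric.infDist_le_infDist_of_subset ?_ ⟨0, (greedySpan f m).zero_mem⟩).trans
    ((hf m).2 (f n) (hf n).1)
  exact Submodule.span_mono (Set.image_mono (Set.Iio_subset_Iio hmn))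

theorem exists_detForm_eq_prod_greedyErr {X : Type*} [NormedAddCommGroup X] [NormedSpace ℝ X]
    (f : ℕ → X) (N : ℕ) :
    ∃ b : Fin N → X →L[ℝ] ℝ, (∀ j, ‖b j‖ ≤ 1) ∧
      detForm b (fun i : Fin N => f i) = ∏ i : Fin N, greedyErr f i := by
  have hb : ∀ j : Fin N, ∃ b : X →L[ℝ] ℝ, ‖b‖ ≤ 1 ∧ (∀ y ∈ greedySpan f j, b y = 0) ∧
      b (f j) = greedyErr f j := by
    intro j
    have : FiniteDimensional ℝ (greedySpan f j) :=
      FiniteDimensional.span_of_finite ℝ ((Set.finite_Iio (j : ℕ)).image f)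
    exact exists_dual_eq_infDist _ (Submodule.closed_of_finiteDimensional _) _
  choose b hb1 hb0 hb using hb
  refine ⟨b, hb1, ?_⟩
  rw [detForm_apply, Matrix.det_of_isLowerTriangular]
  · simp [hb]
  · intro i j hij
    exact hb0 j _ (Submodule.subset_span ⟨i, hij, rfl⟩)

theorem IsGreedySeq.greedyErr_pow_le {E X : Type*} [NormedAddCommGroup E] [NormedSpace ℝ E]
    [NormedAddCommGroup X] [NormedSpace ℝ X] (T : E →L[ℝ] X) {K : Set X}
    (hKT : K ⊆ T '' Metric.closedBall 0 1) {f : ℕ → X} (hf : IsGreedySeq K f) {n : ℕ}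
    (hn : n ≠ 0) :
    greedyErr f (3 * n - 1) ^ (3 * n) ≤
      (12 * groth X n) ^ (3 * n) * (∏ k ∈ Finset.range n, kolWidthOp T k) ^ 3 := by
  obtain ⟨b, hb1, hb⟩ := exists_detForm_eq_prod_greedyErr f (3 * n)
  have hlow : greedyErr f (3 * n - 1) ^ (3 * n) ≤ |detForm b (fun i : Fin (3 * n) => f i)| := by
    rw [hb, abs_of_nonneg (Finset.prod_nonneg fun (i : Fin (3 * n)) _ => greedyErr_nonneg f i)]
    calc _ = ∏ _i : Fin (3 * n), greedyErr f (3 * n - 1) := by simp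
      _ ≤ _ := Finset.prod_le_prod (fun _ _ => greedyErr_nonneg f _)
        fun i _ => hf.greedyErr_antitone (by omega)
  have hε : ∀ ε : ℝ, 0 < ε → greedyErr f (3 * n - 1) ^ (3 * n) ≤
      (12 * groth X n) ^ (3 * n) * (∏ k ∈ Finset.range n, (kolWidthOp T k + ε)) ^ 3 := by
    intro ε hε
    have hne : ∀ k, (Finset.range (k + 1)).Nonempty := fun k => Finset.nonempty_range_add_one
    set δ : ℕ → ℝ := fun k => (Finset.range (k + 1)).inf' (hne k) (kolWidthOp T) + ε with hδ
    have hδanti : Antitone δ := fun m k hmk => by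
      simp only [hδ]
      gcongr
    have hδ0 : ∀ k, 0 < δ k := fun k =>
      add_pos_of_nonneg_of_pos (Finset.le_inf' _ _ fun j _ => kolWidthOp_nonneg T j) hε
    have hup := abs_alternating_le_of_approx (detForm b)
      (fun v hv => abs_detForm_le hn v b hv hb1) (T '' Metric.closedBall 0 1) δ hδanti hδ0
      (fun a => by
        obtain ⟨j, hj, hja⟩ := Finset.exists_mem_eq_inf' (hne a) (kolWidthOp T)
        obtain ⟨L, hfd, hrank, hL⟩ := exists_approx_of_kolWidthOp T j hε
        refine ⟨L, hfd, hrank.trans (Nat.lt_succ_iff.1 (Finset.mem_range.1 hj)), ?_⟩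
        simp only [hδ, hja]
        exact hL) (3 * n) Finset.univ (by simp) (fun i => f i)
      (fun i _ => hKT (hf i).1) (by simp)
    refine hlow.trans (hup.trans ?_)
    have hprod : ∏ k ∈ Finset.range (3 * n), δ (k / 3) = (∏ k ∈ Finset.range n, δ k) ^ 3 := by
      clear hup hlow hb hb1 b hn
      induction n with
      | zero => simp
      | succ n ih =>
        rw [Nat.mul_succ, Finset.prod_range_succ, Finset.prod_range_succ,
          Finset.prod_range_succ, ih, Finset.prod_range_succ, mul_pow,
          show (3 * n) / 3 = n by omega, show (3 * n + 1) / 3 = n by omega,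
          show (3 * n + 2) / 3 = n by omega]
        ring
    rw [hprod, ← mul_pow, show 3 * groth X n * 4 = 12 * groth X n by ring]
    have := groth_nonneg X n
    refine mul_le_mul_of_nonneg_left (pow_le_pow_left₀
      (Finset.prod_nonneg fun k _ => (hδ0 k).le) ?_ 3) (by positivity)
    refine Finset.prod_le_prod (fun k _ => (hδ0 k).le) fun k _ => ?_
    simp only [hδ]
    gcongr
    exact Finset.inf'_le _ (by simp)
  have hcont : Continuous fun ε : ℝ =>
      (12 * groth X n) ^ (3 * n) * (∏ k ∈ Finset.range n, (kolWidthOp T k + ε)) ^ 3 := by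
    fun_prop
  have hlim := (hcont.tendsto 0).mono_left (nhdsWithin_le_nhds (s := Set.Ioi 0))
  simp only [add_zero] at hlim
  exact ge_of_tendsto hlim (eventually_nhdsWithin_of_forall hε)

theorem greedy_bound_image_of_hilbert_ball
    {X : Type*} [NormedAddCommGroup X] [NormedSpace ℝ X] [CompleteSpace X]
    (T : lp (fun _ : ℕ => ℝ) 2 →L[ℝ] X) (hT : IsCompactOperator T)
    (K : Set X) (hKc : IsCompact K) (hKne : K.Nonempty)
    (hKT : K ⊆ T '' Metric.closedBall 0 1) :
    ∀ f : ℕ → X, IsGreedySeq K f → ∀ n : ℕ, 1 ≤ n →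
      greedyErr f (3 * n - 1) ≤
        3 * Real.exp 1 ^ 2 * groth X n *
          (∏ k ∈ Finset.range n, kolWidthOp T k) ^ ((1 : ℝ) / n) := by
  intro f hf n hn
  have hn0 : n ≠ 0 := by omega
  have hg := groth_nonneg X n
  set p := ∏ k ∈ Finset.range n, kolWidthOp T k with hp
  have hp0 : 0 ≤ p := Finset.prod_nonneg fun k _ => kolWidthOp_nonneg T k
  have hroot : (p ^ ((1 : ℝ) / n)) ^ n = p := by
    rw [one_div, Real.rpow_inv_natCast_pow hp0 hn0]
  have hle : greedyErr f (3 * n - 1) ≤ 12 * groth X n * p ^ ((1 : ℝ) / n) := by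
    refine le_of_pow_le_pow_left₀ (n := 3 * n) (by omega) (by positivity) ?_
    refine (hf.greedyErr_pow_le T hKT hn0).trans_eq ?_
    rw [mul_pow _ (p ^ ((1 : ℝ) / n)), mul_comm 3 n, pow_mul (p ^ ((1 : ℝ) / n)), hroot]
  refine hle.trans ?_
  gcongr
  nlinarith [Real.exp_one_gt_d9]
end

section
/- Let X be a Banach space, T : ℓ₂ → X a compact linear operator, K = T(B_{ℓ₂}), and let f_0, …, f_{N−1} be the elements produced by a greedy sequence for K, with σ_k(K)_X > 0 for k = 0, …, N−1. Then there exists an orthonormal system e_0, …, e_{N−1} in ℓ₂ such that T e_k = f_k for k = 0, …, N−1. -/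
open scoped BigOperators NNReal ENNReal

lemma infDist_submodule_eq_norm_mkQ {X : Type*} [NormedAddCommGroup X] [NormedSpace ℝ X]
    (V : Submodule ℝ X) (x : X) : Metric.infDist x (V : Set X) = ‖V.mkQ x‖ :=
  (QuotientAddGroup.norm_mk (S := V.toAddSubgroup) x).symm

/-- A bound on the quotient seminorm `x ↦ dist(T x, V)` over the unit ball extends to the whole
space by homogeneity. -/
lemma norm_mkQ_le_mul_norm {E X : Type*} [NormedAddCommGroup E] [NormedSpace ℝ E]
    [NormedAddCommGroup X] [NormedSpace ℝ X] (T : E →L[ℝ] X) (V : Submodule ℝ X) {C : ℝ}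
    (hC : ∀ x : E, ‖x‖ ≤ 1 → ‖V.mkQ (T x)‖ ≤ C) (u : E) : ‖V.mkQ (T u)‖ ≤ C * ‖u‖ := by
  rcases eq_or_ne u 0 with rfl | hu
  · simp
  have hn : 0 < ‖u‖ := norm_pos_iff.mpr hu
  have h := hC (‖u‖⁻¹ • u) (by simp [norm_smul, hn.ne'])
  rw [map_smul, map_smul, norm_smul, norm_inv, norm_norm, inv_mul_le_iff₀ hn] at h
  linarith

lemma inner_eq_zero_of_one_le_norm_sub_smul {E : Type*} [NormedAddCommGroup E]
    [InnerProductSpace ℝ E] {x y : E} (hx : ‖x‖ = 1) (hy : ‖y‖ ≤ 1)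
    (h : ∀ t : ℝ, 1 ≤ ‖x - t • y‖) : inner ℝ x y = 0 := by
  have h1 : 1 ≤ ‖x - inner ℝ x y • y‖ ^ 2 := one_le_pow₀ (h _)
  rw [norm_sub_sq_real, inner_smul_right, norm_smul, hx, mul_pow, Real.norm_eq_abs, sq_abs] at h1
  have h2 : ‖y‖ ^ 2 ≤ 1 := pow_le_one₀ (norm_nonneg y) hy
  have h3 := mul_le_mul_of_nonneg_left h2 (sq_nonneg (inner ℝ x y))
  exact pow_eq_zero_iff two_ne_zero |>.mp (le_antisymm (by linarith) (sq_nonneg _))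

theorem greedy_orthonormal_lift
    {X : Type*} [NormedAddCommGroup X] [NormedSpace ℝ X] [CompleteSpace X]
    (T : lp (fun _ : ℕ => ℝ) 2 →L[ℝ] X) (hT : IsCompactOperator T)
    (K : Set X) (hK : K = T '' Metric.closedBall 0 1)
    (f : ℕ → X) (hf : IsGreedySeq K f) (N : ℕ)
    (hpos : ∀ k : ℕ, k < N → 0 < greedyErr f k) :
    ∃ e : Fin N → lp (fun _ : ℕ => ℝ) 2,
      Orthonormal ℝ e ∧ ∀ k : Fin N, T (e k) = f (k : ℕ) := by
  subst hK
  choose e he hTe using fun k => (hf k).1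
  have he' (k : ℕ) : ‖e k‖ ≤ 1 := mem_closedBall_zero_iff.mp (he k)
  have key (k : ℕ) (hk : k < N) (y : lp (fun _ : ℕ => ℝ) 2) (hy : T y ∈ greedySpan f k) :
      1 ≤ ‖e k - y‖ := by
    have h := norm_mkQ_le_mul_norm T (greedySpan f k) (C := greedyErr f k)
      (fun x hx => by
        rw [← infDist_submodule_eq_norm_mkQ]
        exact (hf k).2 _ ⟨x, mem_closedBall_zero_iff.mpr hx, rfl⟩) (e k - y)
    have hy0 : (greedySpan f k).mkQ (T y) = 0 := by simpa using hy
    rw [map_sub, map_sub, hy0, sub_zero, hTe, ← infDist_submodule_eq_norm_mkQ] at h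
    exact (le_mul_iff_one_le_right (hpos k hk)).mp h
  have hnorm (k : ℕ) (hk : k < N) : ‖e k‖ = 1 :=
    le_antisymm (he' k) (by simpa using key k hk 0 (by simp))
  have horth (k : ℕ) (hk : k < N) (j : ℕ) (hj : j < k) : inner ℝ (e k) (e j) = 0 :=
    inner_eq_zero_of_one_le_norm_sub_smul (hnorm k hk) (he' j) fun t => key k hk _ <| by
      rw [map_smul, hTe]
      exact Submodule.smul_mem _ t (Submodule.subset_span ⟨j, hj, rfl⟩)
  refine ⟨fun k => e k, ⟨fun k => hnorm k k.2, fun i j hij => ?_⟩, fun k => hTe k⟩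
  rcases lt_or_gt_of_ne hij with h | h
  · exact (real_inner_comm _ _).trans (horth j j.2 i h)
  · exact horth i i.2 j h
end

section
/- Let 2 < q < ∞ and α > 0, and let K = {n^{−α}·u_n : n ≥ 1} ∪ {0} ⊂ ℓ_q, where (u_n)_{n≥1} is the canonical unit vector basis of ℓ_q. Then K is compact and for every greedy sequence for K one has σ_n(K)_{ℓ_q} = (n+1)^{−α} for all n ≥ 0. -/
open scoped BigOperators NNReal ENNReal

theorem norm_smul_lp_single {q : ℝ≥0∞} [Fact (1 ≤ q)] (c : ℝ) (m : ℕ) :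
    ‖c • (lp.single q m 1 : lp (fun _ : ℕ => ℝ) q)‖ = |c| := by
  rw [norm_smul, lp.norm_single (zero_lt_one.trans_le Fact.out), norm_one, mul_one,
    Real.norm_eq_abs]

/-- A basis vector whose coordinate vanishes on `V` is as far from `V` as from the origin. -/
theorem infDist_smul_lp_single {q : ℝ≥0∞} [Fact (1 ≤ q)] (c : ℝ) (m : ℕ)
    (V : Submodule ℝ (lp (fun _ : ℕ => ℝ) q)) (hV : ∀ x ∈ V, x m = 0) :
    Metric.infDist (c • (lp.single q m 1 : lp (fun _ : ℕ => ℝ) q))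
      (V : Set (lp (fun _ : ℕ => ℝ) q)) = |c| := by
  apply le_antisymm
  · refine (Metric.infDist_le_dist_of_mem V.zero_mem).trans ?_
    rw [dist_zero_right, norm_smul_lp_single]
  · refine (Metric.le_infDist ⟨0, V.zero_mem⟩).2 fun x hx => ?_
    rw [dist_eq_norm]
    have h := lp.norm_apply_le_norm (zero_lt_one.trans_le Fact.out : 0 < q).ne'
      (c • (lp.single q m 1 : lp (fun _ : ℕ => ℝ) q) - x) m
    rw [lp.coeFn_sub, Pi.sub_apply, hV x hx, lp.coeFn_smul, Pi.smul_apply,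
      lp.single_apply_self] at h
    simpa using h

theorem apply_eq_zero_of_mem_greedySpan {q : ℝ≥0∞} [Fact (1 ≤ q)]
    {f : ℕ → lp (fun _ : ℕ => ℝ) q} {n m : ℕ} (hf : ∀ i < n, f i m = 0)
    {x : lp (fun _ : ℕ => ℝ) q} (hx : x ∈ greedySpan f n) : x m = 0 := by
  induction hx using Submodule.span_induction with
  | mem x h => obtain ⟨i, hi, rfl⟩ := h; exact hf i hi
  | zero => rfl
  | add x y _ _ hx hy => simp [hx, hy]
  | smul a x _ hx => simp [hx]

/-- A greedy sequence for the scaled unit vectors picks them in their natural order. -/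
theorem IsGreedySeq.eq_smul_lp_single {q : ℝ≥0∞} [Fact (1 ≤ q)] {α : ℝ} (hα : 0 < α)
    {f : ℕ → lp (fun _ : ℕ => ℝ) q}
    (hf : IsGreedySeq
      ({x | ∃ n : ℕ, 1 ≤ n ∧ x = ((n : ℝ) ^ (-α)) • lp.single q n 1} ∪ {0}) f) (n : ℕ) :
    f n = (((n + 1 : ℕ) : ℝ) ^ (-α)) • lp.single q (n + 1) 1 ∧
      greedyErr f n = ((n + 1 : ℕ) : ℝ) ^ (-α) := by
  induction n using Nat.strong_induction_on with
  | _ n ih =>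
    have hvanish : ∀ m, n < m → ∀ x ∈ greedySpan f n, x m = 0 := fun m hm x hx =>
      apply_eq_zero_of_mem_greedySpan (fun i hi => by
        rw [(ih i hi).1, lp.coeFn_smul, Pi.smul_apply,
          lp.single_apply_ne q (i + 1) _ (show m ≠ i + 1 by omega), smul_zero]) hx
    have hdist : ∀ m, n < m → Metric.infDist
        (((m : ℝ) ^ (-α)) • (lp.single q m 1 : lp (fun _ : ℕ => ℝ) q))
        (greedySpan f n : Set (lp (fun _ : ℕ => ℝ) q)) = (m : ℝ) ^ (-α) := fun m hm => by
      rw [infDist_smul_lp_single _ _ _ (hvanish m hm), abs_of_nonneg (by positivity)]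
    obtain ⟨hmem, hmax⟩ := hf n
    have hlower : ((n + 1 : ℕ) : ℝ) ^ (-α) ≤ greedyErr f n := by
      rw [← hdist (n + 1) n.lt_succ_self]
      exact hmax _ (Or.inl ⟨n + 1, by omega, rfl⟩)
    have hpos : 0 < greedyErr f n := lt_of_lt_of_le (by positivity) hlower
    have hnot : f n ∉ greedySpan f n := fun h => hpos.ne' (Metric.infDist_zero_of_mem h)
    rcases hmem with ⟨m, hm, hfm⟩ | h0
    · have hnm : n < m := by
        by_contra! hle
        refine hnot (Submodule.subset_span ⟨m - 1, show m - 1 < n by omega, ?_⟩)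
        rw [(ih (m - 1) (by omega)).1, hfm, Nat.sub_add_cancel hm]
      have herr : greedyErr f n = (m : ℝ) ^ (-α) := by
        rw [greedyErr, hfm, hdist m hnm]
      have hle : m ≤ n + 1 := by
        by_contra! hlt
        have := Real.rpow_lt_rpow_of_neg (x := ((n + 1 : ℕ) : ℝ)) (y := m) (z := -α)
          (by positivity) (by exact_mod_cast hlt) (by linarith)
        linarith
      obtain rfl : m = n + 1 := by omega
      exact ⟨hfm, herr⟩
    · exact absurd (by rw [Set.mem_singleton_iff.1 h0]; exact Submodule.zero_mem _) hnot

theorem isCompact_scaled_lp_single {q : ℝ≥0∞} [Fact (1 ≤ q)] {α : ℝ} (hα : 0 < α) :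
    IsCompact ({x : lp (fun _ : ℕ => ℝ) q |
      ∃ n : ℕ, 1 ≤ n ∧ x = ((n : ℝ) ^ (-α)) • lp.single q n 1} ∪ {0}) := by
  have hlim : Filter.Tendsto (fun n : ℕ => (((n + 1 : ℕ) : ℝ) ^ (-α)) •
      (lp.single q (n + 1) 1 : lp (fun _ : ℕ => ℝ) q)) Filter.atTop (nhds 0) := by
    rw [tendsto_zero_iff_norm_tendsto_zero]
    simp only [norm_smul_lp_single]
    simpa using ((tendsto_rpow_neg_atTop hα).comp (tendsto_natCast_atTop_atTop.comp
      (Filter.tendsto_add_atTop_nat 1))).abs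
  convert hlim.isCompact_insert_range using 1
  rw [Set.union_singleton]
  congr 1
  ext x
  constructor
  · rintro ⟨n, hn, rfl⟩
    exact ⟨n - 1, by simp only [Nat.sub_add_cancel hn]⟩
  · rintro ⟨n, rfl⟩
    exact ⟨n + 1, by omega, rfl⟩

theorem greedy_errors_of_diagonal_example
    (q : ℝ≥0∞) [Fact (1 ≤ q)] (hq2 : 2 < q) (hqtop : q < ⊤)
    (α : ℝ) (hα : 0 < α)
    (K : Set (lp (fun _ : ℕ => ℝ) q))
    (hK : K = {x | ∃ n : ℕ, 1 ≤ n ∧ x = ((n : ℝ) ^ (-α)) • lp.single q n 1} ∪ {0}) :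
    IsCompact K ∧
      ∀ f : ℕ → lp (fun _ : ℕ => ℝ) q, IsGreedySeq K f →
        ∀ n : ℕ, greedyErr f n = ((n : ℝ) + 1) ^ (-α) := by
  subst hK
  refine ⟨isCompact_scaled_lp_single hα, fun f hf n => ?_⟩
  simpa using (hf.eq_smul_lp_single hα n).2
end
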